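/- arXiv:2605.19610 — 2 statements merged into one kernel-verified Lean document; each statement's English description precedes it below -/
import Mathlib

section
/- Fix A > 0 and X = [−A, 1 + A]. Let r ≥ 2 and q ≥ 2 be integers, let ξ_1 ≤ ξ_2 ≤ … ≤ ξ_{r+1} be points of X, and let i ∈ {1, …, r} be an index such that ξ_{i+1} = ξ_i while ξ_{ν+1} − ξ_ν ≥ δ > 0 for every ν ∈ {1, …, r} with ν ≠ i. Fix x ∈ X with x ≠ ξ_i and define f(y) := ((x − y)_+)^{q−1} for y ∈ X. If δ ≤ 2(1 + 2A)/(q − 1), then the r-th divided difference satisfies |[ξ_1, …, ξ_{r+1}] f| ≤ 4(1 + 2A)^{q−1} / δ^r. -/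
open Real

/-- Divided differences `[x_1, …, x_{m+1}] f` of a function `f` over `m+1` nondecreasing points,
where `f'` is used for a repeated adjacent pair: `[x, x] f = f' x`. -/
noncomputable def divDiff (f f' : ℝ → ℝ) : (m : ℕ) → (Fin (m + 1) → ℝ) → ℝ
  | 0, x => f (x 0)
  | 1, x => if x 0 = x 1 then f' (x 0) else (f (x 1) - f (x 0)) / (x 1 - x 0)
  | (m + 2), x =>
      (divDiff f f' (m + 1) (fun i => x i.succ) - divDiff f f' (m + 1) (fun i => x i.castSucc))
        / (x (Fin.last (m + 2)) - x 0)

/-- Divided differences of a bounded function over points that are `δ`-separated up to a single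
repetition: the constant is `2` at first order and `4` afterwards. -/
theorem abs_divDiff_le_of_separated {f f' : ℝ → ℝ} {M δ : ℝ} (hM : 0 ≤ M) (hδ : 0 < δ) (m : ℕ)
    (x : Fin (m + 2) → ℝ)
    (hf : ∀ j, 0 ≤ f (x j) ∧ f (x j) ≤ M)
    (hf' : ∀ j, |f' (x j)| ≤ 2 * M / δ)
    (hadj : ∀ j : Fin (m + 1), x j.castSucc = x j.succ ∨ δ ≤ x j.succ - x j.castSucc)
    (hsep : ∀ j k : Fin (m + 2), j ≤ k → ((k : ℕ) - (j : ℕ) - 1 : ℝ) * δ ≤ x k - x j) :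
    |divDiff f f' (m + 1) x| ≤ 4 * M / δ ^ (m + 1) ∧
      |divDiff f f' (m + 1) x| ≤ 2 * (m + 1) * M / δ ^ (m + 1) := by
  induction m with
  | zero =>
    have key : |divDiff f f' 1 x| ≤ 2 * M / δ := by
      unfold divDiff
      split_ifs with h
      · exact hf' 0
      · have hgap : δ ≤ x 1 - x 0 := (hadj 0).resolve_left h
        rw [abs_div, abs_of_pos (hδ.trans_le hgap)]
        have hnum : |f (x 1) - f (x 0)| ≤ 2 * M := by
          rw [abs_le]
          constructor <;> linarith [(hf 0).1, (hf 0).2, (hf 1).1, (hf 1).2]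
        exact div_le_div₀ (by positivity) hnum hδ hgap
    have hle : 2 * M / δ ≤ 4 * M / δ := by
      gcongr
      norm_num
    constructor
    · simpa using key.trans hle
    · simpa using key
  | succ m ih =>
    have hs := (ih (fun j => x j.succ) (fun j => hf _) (fun j => hf' _) (fun j => hadj j.succ)
      (fun j k hjk => by simpa using hsep j.succ k.succ (by simpa using hjk))).2
    have hc := (ih (fun j => x j.castSucc) (fun j => hf _) (fun j => hf' _)
      (fun j => hadj j.castSucc)
      (fun j k hjk => by simpa using hsep j.castSucc k.castSucc (by simpa using hjk))).2
    have hspread : ((m : ℝ) + 1) * δ ≤ x (Fin.last (m + 2)) - x 0 := by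
      have h := hsep 0 (Fin.last (m + 2)) (Fin.zero_le _)
      simp only [Fin.val_last, Fin.val_zero] at h
      push_cast at h
      linarith
    have hpos : 0 < ((m : ℝ) + 1) * δ := by positivity
    have key : |divDiff f f' (m + 2) x| ≤ 4 * M / δ ^ (m + 2) := by
      unfold divDiff
      rw [abs_div, abs_of_pos (hpos.trans_le hspread)]
      calc _ ≤ (2 * (m + 1) * M / δ ^ (m + 1) + 2 * (m + 1) * M / δ ^ (m + 1)) /
              (((m : ℝ) + 1) * δ) :=
            div_le_div₀ (by positivity) ((abs_sub _ _).trans (add_le_add hs hc)) hpos hspread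
        _ = 4 * M / δ ^ (m + 2) := by
            field_simp
            ring
    refine ⟨key, key.trans ?_⟩
    gcongr
    push_cast
    linarith [(Nat.cast_nonneg m : (0 : ℝ) ≤ m)]

/-- Points with all adjacent gaps at least `δ`, except for one index `i`, are `δ`-separated up to
one gap. -/
theorem mul_le_sub_of_gap {r : ℕ} {ξ : Fin (r + 1) → ℝ} (hmono : Monotone ξ) {i : Fin r} {δ : ℝ}
    (hδ : 0 < δ) (hgap : ∀ ν : Fin r, ν ≠ i → δ ≤ ξ ν.succ - ξ ν.castSucc)
    (j k : Fin (r + 1)) (hjk : j ≤ k) :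
    ((k : ℕ) - (j : ℕ) - 1 : ℝ) * δ ≤ ξ k - ξ j := by
  have hg : Monotone fun j : Fin (r + 1) =>
      ξ j - (j : ℕ) * δ + if (i : ℕ) < (j : ℕ) then δ else 0 := by
    rw [Fin.monotone_iff_le_succ]
    intro ν
    simp only [Fin.val_castSucc, Fin.val_succ]
    push_cast
    by_cases h : ν = i
    · subst h
      have := hmono (Fin.castSucc_le_succ ν)
      simp only [lt_irrefl, if_false, Nat.lt_succ_self, if_true]
      linarith
    · have := hgap ν h
      have hne : (ν : ℕ) ≠ i := fun e => h (Fin.ext e)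
      split_ifs <;> first | omega | linarith
  have h := hg hjk
  dsimp only at h
  split_ifs at h <;> linarith

/-- Fix `A > 0` and `X = [−A, 1+A]`. Let `r, q ≥ 2`, let
`ξ_1 ≤ … ≤ ξ_{r+1}` be points of `X` with exactly one repeated adjacent pair at position `i`
(`ξ_{i+1} = ξ_i`), all other adjacent gaps being at least `δ > 0`.
For `x ∈ X` with `x ≠ ξ_i` and `f(y) = ((x − y)_+)^{q−1}`, if `δ ≤ 2(1+2A)/(q−1)`, then
`|[ξ_1, …, ξ_{r+1}] f| ≤ 4 (1+2A)^{q−1} / δ^r`. -/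
theorem divided_difference_bound
    (A : ℝ) (hA : 0 < A) (r q : ℕ) (hr : 2 ≤ r) (hq : 2 ≤ q)
    (ξ : Fin (r + 1) → ℝ) (hmono : Monotone ξ)
    (hmem : ∀ j, ξ j ∈ Set.Icc (-A) (1 + A))
    (i : Fin r) (heq : ξ i.succ = ξ i.castSucc)
    (δ : ℝ) (hδ : 0 < δ)
    (hgap : ∀ ν : Fin r, ν ≠ i → δ ≤ ξ ν.succ - ξ ν.castSucc)
    (x : ℝ) (hx : x ∈ Set.Icc (-A) (1 + A)) (hxi : x ≠ ξ i.castSucc)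
    (hδ2 : δ ≤ 2 * (1 + 2 * A) / ((q : ℝ) - 1)) :
    |divDiff (fun y => (max (x - y) 0) ^ (q - 1))
        (fun y => -((q : ℝ) - 1) * (max (x - y) 0) ^ (q - 2)) r ξ|
      ≤ 4 * (1 + 2 * A) ^ (q - 1) / δ ^ r := by
  obtain ⟨n, rfl⟩ : ∃ n, r = n + 1 := ⟨r - 1, by omega⟩
  obtain ⟨p, rfl⟩ : ∃ p, q = p + 2 := ⟨q - 2, by omega⟩
  have hL : 0 < 1 + 2 * A := by linarith
  have hcast : (((p + 2 : ℕ) : ℝ) - 1) = p + 1 := by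
    push_cast
    ring
  have hp : (0 : ℝ) < p + 1 := by positivity
  rw [hcast, le_div_iff₀ hp] at hδ2
  have hmax : ∀ j, max (x - ξ j) 0 ≤ 1 + 2 * A := fun j =>
    max_le (by linarith [hx.2, (hmem j).1]) hL.le
  refine (abs_divDiff_le_of_separated (by positivity) hδ n ξ (fun j => ⟨by positivity, ?_⟩)
    (fun j => ?_) (fun j => ?_) (mul_le_sub_of_gap hmono hδ hgap)).1
  · exact pow_le_pow_left₀ (le_max_right _ _) (hmax j) _
  · rw [hcast, abs_mul, abs_neg, abs_of_pos hp, abs_of_nonneg (by positivity), le_div_iff₀ hδ]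
    simp only [Nat.add_sub_cancel, show p + 2 - 1 = p + 1 from rfl]
    calc ((p : ℝ) + 1) * max (x - ξ j) 0 ^ p * δ
        = δ * (p + 1) * max (x - ξ j) 0 ^ p := by ring
      _ ≤ 2 * (1 + 2 * A) * (1 + 2 * A) ^ p :=
          mul_le_mul hδ2 (pow_le_pow_left₀ (le_max_right _ _) (hmax j) _) (by positivity)
            (by positivity)
      _ = 2 * (1 + 2 * A) ^ (p + 1) := by ring
  · by_cases h : j = i
    · exact Or.inl (h ▸ heq.symm)
    · exact Or.inr (hgap j h)
end

section
/- Let J ∈ ℕ, φ > 0, B > 0, and 0 < κ ≤ B. Let α = (α_1, …, α_J) ∈ ℝ^J with |α_l| ≤ B for all l, and let β_1, …, β_J be i.i.d. N(0, φ²) random variables. Then P( |β_l − α_l| ≤ κ and |β_l| ≤ B for all l = 1, …, J ) ≥ ( κ/(√(2π) φ) · exp(−B²/(2φ²)) )^J. -/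
open MeasureTheory ProbabilityTheory Real

/-- An interval `[c, c + κ]` inside `[-B, B]` has `N(0, φ²)`-mass at least its length times the
minimum of the density on `[-B, B]`. -/
lemma gaussianReal_Icc_lower_bound {φ B κ c : ℝ} (hφ : 0 < φ)
    (hc : -B ≤ c) (hcB : c + κ ≤ B) :
    ENNReal.ofReal (κ / (√(2 * π) * φ) * exp (-B ^ 2 / (2 * φ ^ 2)))
      ≤ gaussianReal 0 (φ.toNNReal ^ 2) (Set.Icc c (c + κ)) := by
  have hv : φ.toNNReal ^ 2 ≠ 0 := pow_ne_zero _ (by simpa using hφ)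
  have hdens : ∀ x ∈ Set.Icc c (c + κ),
      ENNReal.ofReal ((√(2 * π) * φ)⁻¹ * exp (-B ^ 2 / (2 * φ ^ 2)))
        ≤ gaussianPDF 0 (φ.toNNReal ^ 2) x := by
    intro x hx
    have hx2 : x ^ 2 ≤ B ^ 2 := sq_le_sq' (by linarith [hx.1]) (by linarith [hx.2])
    rw [gaussianPDF_def]
    apply ENNReal.ofReal_le_ofReal
    rw [gaussianPDFReal_def]
    simp only [NNReal.coe_pow, coe_toNNReal φ hφ.le, sub_zero]
    rw [Real.sqrt_mul (by positivity) (φ ^ 2), Real.sqrt_sq hφ.le]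
    gcongr
  rw [gaussianReal_apply 0 hv]
  calc ENNReal.ofReal (κ / (√(2 * π) * φ) * exp (-B ^ 2 / (2 * φ ^ 2)))
      = ∫⁻ _ in Set.Icc c (c + κ),
          ENNReal.ofReal ((√(2 * π) * φ)⁻¹ * exp (-B ^ 2 / (2 * φ ^ 2))) := by
        rw [setLIntegral_const, Real.volume_Icc, ← ENNReal.ofReal_mul (by positivity)]
        congr 1
        ring
    _ ≤ ∫⁻ x in Set.Icc c (c + κ), gaussianPDF 0 (φ.toNNReal ^ 2) x :=
        setLIntegral_mono' measurableSet_Icc hdens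

/-- If `|a| ≤ B` and `κ ≤ B`, the intersection of `[a - κ, a + κ]` with `[-B, B]` contains an
interval of length `κ`. -/
lemma exists_Icc_subset_abs_sub_le {a B κ : ℝ} (hκ : 0 ≤ κ) (hκB : κ ≤ B) (ha : |a| ≤ B) :
    ∃ c, -B ≤ c ∧ c + κ ≤ B ∧ Set.Icc c (c + κ) ⊆ {x | |x - a| ≤ κ ∧ |x| ≤ B} := by
  obtain ⟨ha1, ha2⟩ := abs_le.mp ha
  obtain ⟨c, h1, h2, h3, h4⟩ : ∃ c, -B ≤ c ∧ c + κ ≤ B ∧ a - κ ≤ c ∧ c ≤ a := by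
    rcases le_total 0 a with h | h
    · exact ⟨a - κ, by linarith, by linarith, by linarith, by linarith⟩
    · exact ⟨a, by linarith, by linarith, by linarith, by linarith⟩
  refine ⟨c, h1, h2, fun x hx => ⟨abs_le.mpr ⟨?_, ?_⟩, abs_le.mpr ⟨?_, ?_⟩⟩⟩ <;>
    linarith [hx.1, hx.2]

/-- Let `β_1, …, β_J` be i.i.d. `N(0, φ²)` and `α ∈ ℝ^J` with `|α_l| ≤ B`
for all `l`, where `0 < κ ≤ B`. Then
`P(∀ l, |β_l − α_l| ≤ κ ∧ |β_l| ≤ B) ≥ (κ / (√(2π) φ) · exp(−B²/(2φ²)))^J`. -/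
theorem gaussian_box_lower_bound
    (J : ℕ) (φ B κ : ℝ) (hφ : 0 < φ) (hB : 0 < B) (hκ0 : 0 < κ) (hκB : κ ≤ B)
    (α : Fin J → ℝ) (hα : ∀ l, |α l| ≤ B) :
    ENNReal.ofReal ((κ / (Real.sqrt (2 * π) * φ) * Real.exp (-B ^ 2 / (2 * φ ^ 2))) ^ J)
      ≤ (Measure.pi fun _ : Fin J => gaussianReal 0 (φ.toNNReal ^ 2))
          {β : Fin J → ℝ | ∀ l, |β l - α l| ≤ κ ∧ |β l| ≤ B} := by
  have hset : {β : Fin J → ℝ | ∀ l, |β l - α l| ≤ κ ∧ |β l| ≤ B}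
      = Set.univ.pi fun l => {x | |x - α l| ≤ κ ∧ |x| ≤ B} := by
    ext β
    simp
  rw [hset, Measure.pi_pi, ENNReal.ofReal_pow (by positivity)]
  calc _ = ∏ _l : Fin J,
        ENNReal.ofReal (κ / (√(2 * π) * φ) * exp (-B ^ 2 / (2 * φ ^ 2))) := by simp
    _ ≤ _ := Finset.prod_le_prod' fun l _ => by
      obtain ⟨c, hc, hcB, hsub⟩ := exists_Icc_subset_abs_sub_le hκ0.le hκB (hα l)
      exact (gaussianReal_Icc_lower_bound hφ hc hcB).trans (measure_mono hsub)
end
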